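/- arXiv:0903.4872 — 2 statements merged into one kernel-verified Lean document; each statement's English description precedes it below -/
import Mathlib

section
/- The relation χ₀ defined by (g₁,g₂) ∈ χ₀ ⟺ g₂ ∈ f({g₁}) is the smallest among all left regular and right negative quasi-orders χ on G (writing g₁ ⊏ g₂ for (g₁,g₂) ∈ χ) which contain the natural semilattice order ≤ and satisfy: (i) g₁ ⊢ g₂ implies g₁ ⊏ g₁g₂; and (ii) g ⊏ g₁⋏g₂ and g ⊏ (g₂⋏g₃)x imply g ⊏ (g₁⋏g₂⋏g₃)x for all g,g₁,g₂,g₃ ∈ G and x ∈ G* (including the version with the factor x absent). That is, χ₀ itself has all these properties, and χ₀ ⊆ χ for every relation χ with these properties. -/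
/-- `act mul g x` is the product `g·x` where `x` ranges over `G* = G ∪ {e}`
(`none` playing the role of the adjoined identity `e`, so `g·e = g`). -/
def act {G : Type*} (mul : G → G → G) (g : G) : Option G → G
  | none => g
  | some h => mul g h

/-- `rel δ g y` means `g ⊢ y` where `y` ranges over `G* = G ∪ {e}`
(by definition `g ⊢ e` holds for every `g`). -/
def rel {G : Type*} (δ : G → G → Prop) (g : G) : Option G → Prop
  | none => True
  | some h => δ g h

/-- The natural order of the semilattice `(G,⋏)`: `a ≤ b ↔ a⋏b = a`. -/
def sle {G : Type*} (meet : G → G → G) (a b : G) : Prop := meet a b = a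

/-- `F₁(H) = {z ∈ G | ∃ u,v,w ∈ G, ∃ x,y,t ∈ G*,
(u⋏v⋏w)x ⊢ y ∧ (u⋏v⋏w)xy ≤ zt ∧ u⋏v ∈ H ∧ (v⋏w)x ∈ H}`. -/
def F1 {G : Type*} (mul meet : G → G → G) (δ : G → G → Prop) (H : Set G) : Set G :=
  {z | ∃ u v w : G, ∃ x y t : Option G,
    rel δ (act mul (meet (meet u v) w) x) y ∧
    sle meet (act mul (act mul (meet (meet u v) w) x) y) (act mul z t) ∧
    meet u v ∈ H ∧ act mul (meet v w) x ∈ H}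

/-- The iterated sets `Fₙ(H)`: `F₀(H) = H` and `Fₙ(H) = F₁(F_{n-1}(H))`. -/
def FIter {G : Type*} (mul meet : G → G → G) (δ : G → G → Prop) : ℕ → Set G → Set G
  | 0, H => H
  | n + 1, H => F1 mul meet δ (FIter mul meet δ n H)

/-- `H` is f-closed: for all x,y,t ∈ G* and z,u,v,w ∈ G,
(u⋏v⋏w)x ⊢ y, (u⋏v⋏w)xy ≤ zt, u⋏v ∈ H and (v⋏w)x ∈ H imply z ∈ H. -/
def FClosed {G : Type*} (mul meet : G → G → G) (δ : G → G → Prop) (H : Set G) : Prop :=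
  ∀ (x y t : Option G) (z u v w : G),
    rel δ (act mul (meet (meet u v) w) x) y →
    sle meet (act mul (act mul (meet (meet u v) w) x) y) (act mul z t) →
    meet u v ∈ H → act mul (meet v w) x ∈ H → z ∈ H

/-- `fcl H` is the f-closure of `H`: the smallest f-closed subset of `G` containing `H`
(the intersection of all f-closed sets containing `H`). -/
def fcl {G : Type*} (mul meet : G → G → G) (δ : G → G → Prop) (H : Set G) : Set G :=
  ⋂₀ {K | FClosed mul meet δ K ∧ H ⊆ K}

/-- `χ` is a left regular and right negative quasi-order containing the semilattice
order `≤` and satisfying (i) `g₁ ⊢ g₂ → g₁ ⊏ g₁g₂` and (ii) `g ⊏ g₁⋏g₂` and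
`g ⊏ (g₂⋏g₃)x` imply `g ⊏ (g₁⋏g₂⋏g₃)x` for all `x ∈ G*` (including the version with
the factor `x` absent). -/
def GoodRel {G : Type*} (mul meet : G → G → G) (δ : G → G → Prop)
    (χ : G → G → Prop) : Prop :=
  (∀ a, χ a a) ∧
  (∀ a b c, χ a b → χ b c → χ a c) ∧
  (∀ x a b, χ a b → χ (mul x a) (mul x b)) ∧
  (∀ x y u, χ x (mul y u) → χ x y) ∧
  (∀ a b, sle meet a b → χ a b) ∧
  (∀ g₁ g₂, δ g₁ g₂ → χ g₁ (mul g₁ g₂)) ∧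
  (∀ (g g₁ g₂ g₃ : G) (x : Option G), χ g (meet g₁ g₂) →
    χ g (act mul (meet g₂ g₃) x) → χ g (act mul (meet (meet g₁ g₂) g₃) x))

section Helpers

variable {G : Type*} {mul meet : G → G → G} {δ : G → G → Prop}

theorem mem_fcl_singleton {a b : G} :
    b ∈ fcl mul meet δ {a} ↔ ∀ K, FClosed mul meet δ K → a ∈ K → b ∈ K := by
  simp [fcl]

theorem mul_act (hassoc : ∀ a b c, mul (mul a b) c = mul a (mul b c)) (a b : G)
    (x : Option G) : mul a (act mul b x) = act mul (mul a b) x := by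
  cases x <;> simp [act, hassoc]

theorem rel_mul (hli : ∀ x y u, δ x y → δ (mul u x) y) {g : G} {y : Option G} (u : G)
    (h : rel δ g y) : rel δ (mul u g) y := by
  cases y with
  | none => trivial
  | some y => exact hli _ _ _ h

theorem sle_mul (hdist : ∀ x y z, mul x (meet y z) = meet (mul x y) (mul x z)) {a b : G}
    (x : G) (h : sle meet a b) : sle meet (mul x a) (mul x b) := by
  unfold sle at *
  rw [← hdist, h]

namespace FClosed

variable {K : Set G}

theorem mem_of_rel_of_sle (hK : FClosed mul meet δ K) (hidem : ∀ a, meet a a = a) {a z : G}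
    {y t : Option G} (ha : a ∈ K) (hr : rel δ a y) (hle : sle meet (act mul a y) (act mul z t)) :
    z ∈ K :=
  hK none y t z a a a (by simpa [act, hidem] using hr) (by simp only [hidem]; exact hle)
    (by simpa [hidem] using ha) (by simpa [act, hidem] using ha)

theorem preimage_mul (hK : FClosed mul meet δ K)
    (hassoc : ∀ a b c, mul (mul a b) c = mul a (mul b c))
    (hli : ∀ x y u, δ x y → δ (mul u x) y)
    (hdist : ∀ x y z, mul x (meet y z) = meet (mul x y) (mul x z)) (a : G) :
    FClosed mul meet δ (mul a ⁻¹' K) := by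
  intro x y t z u v w hr hle huv hvw
  have hr' := rel_mul hli a hr
  have hle' := sle_mul hdist a hle
  simp only [Set.mem_preimage, mul_act hassoc, hdist] at hr' hle' huv hvw
  exact hK x y t (mul a z) _ _ _ hr' hle' huv hvw

end FClosed

theorem GoodRel.fClosed {χ : G → G → Prop} (hχ : GoodRel mul meet δ χ) (g : G) :
    FClosed mul meet δ {z | χ g z} := by
  obtain ⟨-, htrans, -, hneg, hsle, hδ, hmeet⟩ := hχ
  intro x y t z u v w hr hle huv hvw
  have hx := hmeet g u v w x huv hvw
  have hy : χ g (act mul (act mul (meet (meet u v) w) x) y) := by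
    cases y with
    | none => exact hx
    | some y => exact htrans _ _ _ hx (hδ _ _ hr)
  have hz := htrans _ _ _ hy (hsle _ _ hle)
  cases t with
  | none => exact hz
  | some t => exact hneg _ _ _ hz

end Helpers

/-- The relation `χ₀`, defined by `(g₁,g₂) ∈ χ₀ ⟺ g₂ ∈ f({g₁})`, is the smallest
left regular and right negative quasi-order on `G` containing the semilattice order
and satisfying conditions (i) and (ii). -/
theorem statement_17 {G : Type*} (mul meet : G → G → G) (δ : G → G → Prop)
    (hassoc : ∀ a b c, mul (mul a b) c = mul a (mul b c))
    (hcomm : ∀ a b, meet a b = meet b a)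
    (hmassoc : ∀ a b c, meet (meet a b) c = meet a (meet b c))
    (hidem : ∀ a, meet a a = a)
    (hli : ∀ x y u, δ x y → δ (mul u x) y)
    (hdist : ∀ x y z, mul x (meet y z) = meet (mul x y) (mul x z))
    (hmle : ∀ x y z, sle meet (mul (meet x y) z) (mul y z)) :
    GoodRel mul meet δ (fun g₁ g₂ => g₂ ∈ fcl mul meet δ {g₁}) ∧
    (∀ χ : G → G → Prop, GoodRel mul meet δ χ →
      ∀ g₁ g₂, g₂ ∈ fcl mul meet δ {g₁} → χ g₁ g₂) := by
  simp only [mem_fcl_singleton]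
  refine ⟨⟨?_, ?_, ?_, ?_, ?_, ?_, ?_⟩, ?_⟩
  · exact fun a K _ ha => ha
  · exact fun a b c hab hbc K hK ha => hbc K hK (hab K hK ha)
  · exact fun x a b hab K hK ha => hab _ (hK.preimage_mul hassoc hli hdist x) ha
  · exact fun x y u h K hK hx =>
      hK.mem_of_rel_of_sle (y := none) (t := some u) hidem (h K hK hx) trivial (hidem _)
  · exact fun a b h K hK ha =>
      hK.mem_of_rel_of_sle (y := none) (t := none) hidem ha trivial h
  · exact fun a b h K hK ha =>
      hK.mem_of_rel_of_sle (y := some b) (t := none) hidem ha h (hidem _)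
  · exact fun g u v w x huv hvw K hK hg =>
      hK x none none _ u v w trivial (hidem _) (huv K hK hg) (hvw K hK hg)
  · exact fun χ hχ g₁ g₂ h => h _ (hχ.fClosed g₁) (hχ.1 g₁)
end

section
/- An algebraic system (G,·,⋏,δ), where (G,·) is a semigroup, (G,⋏) is a semilattice and δ is a binary relation on G, is isomorphic to some ∩-semigroup (Φ,∘,∩,δ_Φ) of transformations if and only if: δ is a left-ideal relation on (G,·); x(y⋏z) = xy⋏xz; (x⋏y)z ≤ yz; and for every natural number n the two conditions (Aₙ) x⋏y ∈ Fₙ({x}) implies x ≤ y, and (Bₙ) xy ∈ Fₙ({x}) implies (x,y) ∈ δ, hold for all x,y,z ∈ G. -/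
universe u

/-- A transformation (partial map) of `A`, viewed as a binary relation. -/
def IsTransformation {A : Type*} (f : Set (A × A)) : Prop :=
  ∀ ⦃a b c : A⦄, (a, b) ∈ f → (a, c) ∈ f → b = c

/-- Composition of binary relations: `comp g f = g ∘ f`. -/
def comp {A : Type*} (g f : Set (A × A)) : Set (A × A) :=
  {p | ∃ b, (p.1, b) ∈ f ∧ (b, p.2) ∈ g}

/-- The domain of a binary relation. -/
def pr1 {A : Type*} (f : Set (A × A)) : Set A := {a | ∃ b, (a, b) ∈ f}

/-- The image of a binary relation. -/
def pr2 {A : Type*} (f : Set (A × A)) : Set A := {b | ∃ a, (a, b) ∈ f}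

/-- The laws of a semigroup with a semilattice operation over which the product distributes
from the left and is monotone in its left argument. -/
structure IsMeetSemigroup {G : Type*} (mul meet : G → G → G) : Prop where
  assoc : ∀ a b c, mul (mul a b) c = mul a (mul b c)
  meet_comm : ∀ a b, meet a b = meet b a
  meet_assoc : ∀ a b c, meet (meet a b) c = meet a (meet b c)
  idem : ∀ a, meet a a = a
  mul_meet : ∀ x y z, mul x (meet y z) = meet (mul x y) (mul x z)
  meet_mul_le : ∀ x y z, sle meet (mul (meet x y) z) (mul y z)

/-- The product `x·g`, where `x` ranges over `G* = G ∪ {e}`. -/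
def starMul {G : Type*} (mul : G → G → G) : Option G → G → G
  | none, g => g
  | some x, g => mul x g

/-- The class of `x` under the partial equivalence `x ⋏ y ∈ H`. -/
def meetClass {G : Type*} (meet : G → G → G) (H : Set G) (x : G) : Set G := {y | meet x y ∈ H}

/-- The action of `g` by right multiplication on the classes modulo all f-closed sets,
where `none` is the class of the adjoined identity. -/
def classMap {G : Type*} (mul meet : G → G → G) (δ : G → G → Prop) (g : G) :
    Set ((Set G × Option (Set G)) × (Set G × Option (Set G))) :=
  {r | match r with
    | ((H, p), (K, q)) => FClosed mul meet δ H ∧ K = H ∧ ∃ x : Option G,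
      p = x.map (meetClass meet H) ∧ starMul mul x g ∈ H ∧
      q = some (meetClass meet H (starMul mul x g))}

section FClosed

variable {G : Type*} {mul meet : G → G → G} {δ : G → G → Prop} {H : Set G}

theorem starMul_mul (h : IsMeetSemigroup mul meet) (x : Option G) (a b : G) :
    starMul mul x (mul a b) = mul (starMul mul x a) b := by
  cases x
  · rfl
  · exact (h.assoc _ _ _).symm

theorem starMul_meet (h : IsMeetSemigroup mul meet) (x : Option G) (a b : G) :
    starMul mul x (meet a b) = meet (starMul mul x a) (starMul mul x b) := by
  cases x
  · rfl
  · exact h.mul_meet _ _ _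

theorem FClosed.mem_of_sle (h : IsMeetSemigroup mul meet) (hH : FClosed mul meet δ H) {a b : G}
    (ha : a ∈ H) (hab : sle meet a b) : b ∈ H :=
  hH none none none b a a a trivial (by simpa [act, h.idem] using hab)
    (by simpa [h.idem] using ha) (by simpa [act, h.idem] using ha)

theorem FClosed.mem_of_mul_mem (h : IsMeetSemigroup mul meet) (hH : FClosed mul meet δ H)
    {a b : G} (hab : mul a b ∈ H) : a ∈ H :=
  hH none none (some b) a (mul a b) (mul a b) (mul a b) trivial (by simp [act, sle, h.idem])
    (by simpa [h.idem] using hab) (by simpa [act, h.idem] using hab)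

theorem FClosed.mul_mem_of_rel (h : IsMeetSemigroup mul meet) (hH : FClosed mul meet δ H)
    {a b : G} (ha : a ∈ H) (hab : δ a b) : mul a b ∈ H :=
  hH none (some b) none (mul a b) a a a (by simpa [act, rel, h.idem] using hab)
    (by simp [act, sle, h.idem]) (by simpa [h.idem] using ha) (by simpa [act, h.idem] using ha)

theorem IsMeetSemigroup.meet_sle_left (h : IsMeetSemigroup mul meet) (a b : G) :
    sle meet (meet a b) a := by
  rw [sle, h.meet_comm, ← h.meet_assoc, h.idem]

theorem IsMeetSemigroup.meet_sle_right (h : IsMeetSemigroup mul meet) (a b : G) :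
    sle meet (meet a b) b := by
  rw [sle, h.meet_assoc, h.idem]

theorem IsMeetSemigroup.sle_meet (h : IsMeetSemigroup mul meet) {a b c : G}
    (hb : sle meet a b) (hc : sle meet a c) : sle meet a (meet b c) := by
  unfold sle at *
  rw [← h.meet_assoc, hb, hc]

theorem FClosed.meet_trans (h : IsMeetSemigroup mul meet) (hH : FClosed mul meet δ H) {a b c : G}
    (hab : meet a b ∈ H) (hbc : meet b c ∈ H) : meet a c ∈ H := by
  refine hH none none none _ a b c trivial ?_ hab hbc
  refine h.sle_meet ?_ (h.meet_sle_right _ _)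
  change sle meet (meet (meet a b) c) a
  rw [h.meet_assoc]
  exact h.meet_sle_left _ _

theorem FClosed.meet_mul_mem (h : IsMeetSemigroup mul meet) (hH : FClosed mul meet δ H)
    {x y g : G} (hxy : meet x y ∈ H) (hx : mul x g ∈ H) : meet (mul x g) (mul y g) ∈ H := by
  refine hH (some g) none none _ y x x trivial ?_ (by rwa [h.meet_comm])
    (by simpa [act, h.idem] using hx)
  refine h.sle_meet (h.meet_mul_le _ _ _) ?_
  change sle meet (mul (meet (meet y x) x) g) (mul y g)
  rw [h.meet_assoc, h.idem, h.meet_comm]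
  exact h.meet_mul_le _ _ _

theorem FClosed.meetClass_eq (h : IsMeetSemigroup mul meet) (hH : FClosed mul meet δ H) {a b : G}
    (hab : meet a b ∈ H) : meetClass meet H a = meetClass meet H b := by
  ext c
  exact ⟨hH.meet_trans h (by rwa [h.meet_comm]), hH.meet_trans h hab⟩

theorem IsMeetSemigroup.meet_mem_of_meetClass_eq (h : IsMeetSemigroup mul meet) {a b : G}
    (hb : b ∈ H) (hab : meetClass meet H a = meetClass meet H b) : meet a b ∈ H := by
  change b ∈ meetClass meet H a
  rw [hab]
  change meet b b ∈ H
  rwa [h.idem]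

theorem FClosed.meet_starMul_mem (h : IsMeetSemigroup mul meet) (hH : FClosed mul meet δ H)
    {x y : Option G} {g : G} (hx : starMul mul x g ∈ H)
    (hxy : x.map (meetClass meet H) = y.map (meetClass meet H)) :
    meet (starMul mul x g) (starMul mul y g) ∈ H := by
  rcases x with _ | x <;> rcases y with _ | y
  · rwa [h.idem]
  · simp at hxy
  · simp at hxy
  · refine hH.meet_mul_mem h ?_ hx
    rw [h.meet_comm]
    exact h.meet_mem_of_meetClass_eq (hH.mem_of_mul_mem h hx) (Option.some.inj hxy).symm

theorem FClosed.starMul_mem (h : IsMeetSemigroup mul meet) (hH : FClosed mul meet δ H)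
    {x y : Option G} {g : G} (hx : starMul mul x g ∈ H)
    (hxy : x.map (meetClass meet H) = y.map (meetClass meet H)) : starMul mul y g ∈ H :=
  hH.mem_of_sle h (hH.meet_starMul_mem h hx hxy) (h.meet_sle_right _ _)

theorem isTransformation_classMap (h : IsMeetSemigroup mul meet) (g : G) :
    IsTransformation (classMap mul meet δ g) := by
  rintro ⟨H, p⟩ ⟨_, q⟩ ⟨_, r⟩ ⟨hH, rfl, x, hp, hx, hq⟩ ⟨-, rfl, y, hp', hy, hr⟩
  rw [hq, hr, hH.meetClass_eq h (hH.meet_starMul_mem h hx (hp.symm.trans hp'))]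

theorem classMap_mul (h : IsMeetSemigroup mul meet) (a b : G) :
    classMap mul meet δ (mul a b) = comp (classMap mul meet δ b) (classMap mul meet δ a) := by
  ext ⟨⟨H, p⟩, ⟨K, q⟩⟩
  constructor
  · rintro ⟨hH, rfl, x, hp, hx, hq⟩
    rw [starMul_mul h] at hx hq
    exact ⟨(K, some (meetClass meet K (starMul mul x a))),
      ⟨hH, rfl, x, hp, hH.mem_of_mul_mem h hx, rfl⟩,
      ⟨hH, rfl, some (starMul mul x a), rfl, hx, hq⟩⟩
  · rintro ⟨⟨_, r⟩, ⟨hH, rfl, x, hp, hx, hr⟩, ⟨-, rfl, y, hr', hy, hq⟩⟩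
    have hxy : y.map (meetClass meet K) = (some (starMul mul x a)).map (meetClass meet K) :=
      hr'.symm.trans hr
    refine ⟨hH, rfl, x, hp, ?_, ?_⟩ <;> rw [starMul_mul h]
    · exact hH.starMul_mem h hy hxy
    · rw [hq, hH.meetClass_eq h (hH.meet_starMul_mem h hy hxy)]
      rfl

theorem classMap_meet (h : IsMeetSemigroup mul meet) (a b : G) :
    classMap mul meet δ (meet a b) = classMap mul meet δ a ∩ classMap mul meet δ b := by
  ext ⟨⟨H, p⟩, ⟨K, q⟩⟩
  constructor
  · rintro ⟨hH, rfl, x, hp, hx, hq⟩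
    rw [starMul_meet h] at hx hq
    have ha := hH.mem_of_sle h hx (h.meet_sle_left _ _)
    have hb := hH.mem_of_sle h hx (h.meet_sle_right _ _)
    refine ⟨⟨hH, rfl, x, hp, ha, ?_⟩, ⟨hH, rfl, x, hp, hb, ?_⟩⟩ <;> rw [hq]
    · rw [hH.meetClass_eq h]
      rwa [h.meet_sle_left]
    · rw [hH.meetClass_eq h]
      rwa [h.meet_sle_right]
  · rintro ⟨⟨hH, rfl, x, hp, hx, hq⟩, ⟨-, -, y, hp', hy, hq'⟩⟩
    have hyx := hp'.symm.trans hp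
    have hb := hH.starMul_mem h hy hyx
    have hcl : meetClass meet K (starMul mul x a) = meetClass meet K (starMul mul x b) := by
      rw [← hH.meetClass_eq h (hH.meet_starMul_mem h hy hyx)]
      exact Option.some.inj (hq.symm.trans hq')
    have hab := h.meet_mem_of_meetClass_eq hb hcl
    refine ⟨hH, rfl, x, hp, ?_, ?_⟩ <;> rw [starMul_meet h]
    · exact hab
    · rw [hq, ← hH.meetClass_eq h]
      rwa [h.meet_sle_left]

theorem pr2_classMap_subset_pr1 (h : IsMeetSemigroup mul meet)
    (hδ : ∀ x y u, δ x y → δ (mul u x) y) {a b : G} (hab : δ a b) :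
    pr2 (classMap mul meet δ a) ⊆ pr1 (classMap mul meet δ b) := by
  rintro ⟨K, q⟩ ⟨⟨H, p⟩, ⟨hH, rfl, x, hp, hx, hq⟩⟩
  refine ⟨(K, some (meetClass meet K (mul (starMul mul x a) b))),
    hH, rfl, some (starMul mul x a), hq, hH.mul_mem_of_rel h hx ?_, rfl⟩
  cases x
  · exact hab
  · exact hδ _ _ _ hab

theorem none_mem_classMap (hH : FClosed mul meet δ H) {a : G} (ha : a ∈ H) :
    ((H, none), (H, some (meetClass meet H a))) ∈ classMap mul meet δ a :=
  ⟨hH, rfl, none, rfl, ha, rfl⟩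

theorem meet_mem_of_classMap_subset (h : IsMeetSemigroup mul meet) (hH : FClosed mul meet δ H)
    {a b : G} (ha : a ∈ H) (hab : classMap mul meet δ a ⊆ classMap mul meet δ b) :
    meet a b ∈ H := by
  obtain ⟨-, -, x, hx, hb, hcl⟩ := hab (none_mem_classMap hH ha)
  cases x
  · exact h.meet_mem_of_meetClass_eq hb (Option.some.inj hcl)
  · simp at hx

theorem mul_mem_of_pr2_classMap_subset (h : IsMeetSemigroup mul meet)
    (hH : FClosed mul meet δ H) {a b : G} (ha : a ∈ H)
    (hab : pr2 (classMap mul meet δ a) ⊆ pr1 (classMap mul meet δ b)) : mul a b ∈ H := by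
  obtain ⟨⟨_, _⟩, -, -, x, hx, hb, -⟩ := hab ⟨_, none_mem_classMap hH ha⟩
  exact hH.starMul_mem (y := some a) h hb hx.symm

theorem subset_F1 (hidem : ∀ a, meet a a = a) (H : Set G) : H ⊆ F1 mul meet δ H := fun z hz =>
  ⟨z, z, z, none, none, none, trivial, by simp [act, sle, hidem], by rwa [hidem],
    by simpa [act, hidem] using hz⟩

theorem monotone_FIter (hidem : ∀ a, meet a a = a) (H : Set G) :
    Monotone fun n => FIter mul meet δ n H :=
  monotone_nat_of_le_succ fun _ => subset_F1 hidem _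

theorem fClosed_iUnion_FIter (hidem : ∀ a, meet a a = a) (H : Set G) :
    FClosed mul meet δ (⋃ n, FIter mul meet δ n H) := by
  intro x y t z u v w hrel hle huv hvw
  obtain ⟨m, hm⟩ := Set.mem_iUnion.1 huv
  obtain ⟨n, hn⟩ := Set.mem_iUnion.1 hvw
  exact Set.mem_iUnion.2 ⟨max m n + 1, u, v, w, x, y, t, hrel, hle,
    monotone_FIter hidem H (le_max_left m n) hm, monotone_FIter hidem H (le_max_right m n) hn⟩

theorem FClosed.FIter_subset {K : Set G} (hK : FClosed mul meet δ K) (hHK : H ⊆ K) (n : ℕ) :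
    FIter mul meet δ n H ⊆ K := by
  induction n with
  | zero => exact hHK
  | succ n ih =>
    rintro z ⟨u, v, w, x, y, t, hrel, hle, huv, hvw⟩
    exact hK x y t z u v w hrel hle (ih huv) (ih hvw)

theorem sle_iff_subset {A : Type*} {P : G → Set (A × A)} (hinj : Function.Injective P)
    (hmeet : ∀ a b, P (meet a b) = P a ∩ P b) (a b : G) : sle meet a b ↔ P a ⊆ P b := by
  rw [sle, ← hinj.eq_iff, hmeet, Set.inter_eq_left]

theorem mem_pr1_act {A : Type*} {P : G → Set (A × A)}
    (hmul : ∀ a b, P (mul a b) = comp (P b) (P a)) {g : G} {x : Option G} {a : A}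
    (ha : a ∈ pr1 (P (act mul g x))) : a ∈ pr1 (P g) := by
  cases x
  · exact ha
  · simp only [act, hmul] at ha
    obtain ⟨_, b, hb, -⟩ := ha
    exact ⟨b, hb⟩

theorem mem_pr1_act_of_rel {A : Type*} {P : G → Set (A × A)}
    (hmul : ∀ a b, P (mul a b) = comp (P b) (P a))
    (hδ : ∀ a b, δ a b ↔ pr2 (P a) ⊆ pr1 (P b)) {g : G} {y : Option G} {a : A}
    (hg : rel δ g y) (ha : a ∈ pr1 (P g)) : a ∈ pr1 (P (act mul g y)) := by
  cases y
  · exact ha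
  · obtain ⟨b, hb⟩ := ha
    obtain ⟨c, hc⟩ := (hδ _ _).1 hg ⟨a, hb⟩
    simp only [act, hmul]
    exact ⟨c, b, hb, hc⟩

theorem fClosed_setOf_mem_pr1 {A : Type*} {P : G → Set (A × A)}
    (htr : ∀ g, IsTransformation (P g)) (hinj : Function.Injective P)
    (hmul : ∀ a b, P (mul a b) = comp (P b) (P a))
    (hmeet : ∀ a b, P (meet a b) = P a ∩ P b)
    (hδ : ∀ a b, δ a b ↔ pr2 (P a) ⊆ pr1 (P b)) (a : A) :
    FClosed mul meet δ {g | a ∈ pr1 (P g)} := by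
  intro x y t z u v w hrel hle huv hvw
  have hmem : a ∈ pr1 (P (act mul (meet (meet u v) w) x)) := by
    obtain ⟨b, hb⟩ := huv
    rw [hmeet] at hb
    rcases x with _ | x
    · obtain ⟨c, hc⟩ := hvw
      simp only [act, hmeet] at hc ⊢
      obtain rfl := htr v hb.2 hc.1
      exact ⟨b, hb, hc.2⟩
    · obtain ⟨d, c, hc, hd⟩ : a ∈ pr1 (comp (P x) (P (meet v w))) := by
        rw [← hmul]
        exact hvw
      rw [hmeet] at hc
      obtain rfl := htr v hb.2 hc.1
      simp only [act, hmul, hmeet]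
      exact ⟨d, b, ⟨hb, hc.2⟩, hd⟩
  obtain ⟨c, hc⟩ := mem_pr1_act_of_rel hmul hδ hrel hmem
  exact mem_pr1_act hmul ⟨c, (sle_iff_subset hinj hmeet _ _).1 hle hc⟩

end FClosed

/-- An algebraic system (G,·,⋏,δ), where (G,·) is a semigroup and (G,⋏) a semilattice,
is isomorphic to some ∩-semigroup (Φ,∘,∩,δ_Φ) of transformations iff δ is left-ideal,
x(y⋏z) = xy⋏xz, (x⋏y)z ≤ yz, and for every n the conditions
(Aₙ): x⋏y ∈ Fₙ({x}) → x ≤ y and (Bₙ): xy ∈ Fₙ({x}) → (x,y) ∈ δ hold. -/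
theorem statement_19 {G : Type u} (mul meet : G → G → G) (δ : G → G → Prop)
    (hassoc : ∀ a b c, mul (mul a b) c = mul a (mul b c))
    (hcomm : ∀ a b, meet a b = meet b a)
    (hmassoc : ∀ a b c, meet (meet a b) c = meet a (meet b c))
    (hidem : ∀ a, meet a a = a) :
    (∃ (A : Type u) (_ : Nonempty A) (Φ : Set (Set (A × A))),
      (∀ f ∈ Φ, IsTransformation f) ∧
      (∀ f ∈ Φ, ∀ g ∈ Φ, comp g f ∈ Φ) ∧
      (∀ f ∈ Φ, ∀ g ∈ Φ, f ∩ g ∈ Φ) ∧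
      ∃ P : G → Set (A × A),
        (∀ g, P g ∈ Φ) ∧ Function.Injective P ∧ (∀ f ∈ Φ, ∃ g, P g = f) ∧
        (∀ a b, P (mul a b) = comp (P b) (P a)) ∧
        (∀ a b, P (meet a b) = P a ∩ P b) ∧
        (∀ a b, δ a b ↔ pr2 (P a) ⊆ pr1 (P b))) ↔
    ((∀ x y u, δ x y → δ (mul u x) y) ∧
     (∀ x y z, mul x (meet y z) = meet (mul x y) (mul x z)) ∧
     (∀ x y z, sle meet (mul (meet x y) z) (mul y z)) ∧
     (∀ (n : ℕ) (x y : G), meet x y ∈ FIter mul meet δ n {x} → sle meet x y) ∧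
     (∀ (n : ℕ) (x y : G), mul x y ∈ FIter mul meet δ n {x} → δ x y)) := by
  constructor
  · rintro ⟨A, -, Φ, hΦ, -, -, P, hPΦ, hinj, -, hmul, hmeet, hδ⟩
    have htr : ∀ g, IsTransformation (P g) := fun g => hΦ _ (hPΦ g)
    have hdom : ∀ {n x z a}, z ∈ FIter mul meet δ n {x} → a ∈ pr1 (P x) → a ∈ pr1 (P z) :=
      fun hz ha => (fClosed_setOf_mem_pr1 htr hinj hmul hmeet hδ _).FIter_subset
        (Set.singleton_subset_iff.2 ha) _ hz
    refine ⟨fun x y u hxy => ?_, fun x y z => hinj ?_, fun x y z => ?_, fun n x y hxy => ?_,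
      fun n x y hxy => ?_⟩
    · rw [hδ, hmul]
      rintro c ⟨a, b, -, hc⟩
      exact (hδ x y).1 hxy ⟨b, hc⟩
    · simp only [hmul, hmeet]
      ext ⟨a, c⟩
      constructor
      · rintro ⟨b, hb, hc, hc'⟩
        exact ⟨⟨b, hb, hc⟩, ⟨b, hb, hc'⟩⟩
      · rintro ⟨⟨b, hb, hc⟩, ⟨b', hb', hc'⟩⟩
        obtain rfl := htr x hb hb'
        exact ⟨b, hb, hc, hc'⟩
    · rw [sle_iff_subset hinj hmeet, hmul, hmul, hmeet]
      rintro ⟨a, c⟩ ⟨b, hb, hc⟩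
      exact ⟨b, hb.2, hc⟩
    · rw [sle_iff_subset hinj hmeet]
      rintro ⟨a, b⟩ hab
      obtain ⟨c, hc⟩ := hdom hxy ⟨b, hab⟩
      rw [hmeet] at hc
      obtain rfl := htr x hab hc.1
      exact hc.2
    · rw [hδ]
      rintro b ⟨a, hab⟩
      obtain ⟨c, hc⟩ := hdom hxy ⟨b, hab⟩
      rw [hmul] at hc
      obtain ⟨b', hb', hc⟩ := hc
      obtain rfl := htr x hab hb'
      exact ⟨c, hc⟩
  · rintro ⟨hδ, hmm, hle, hA, hB⟩
    have h : IsMeetSemigroup mul meet := ⟨hassoc, hcomm, hmassoc, hidem, hmm, hle⟩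
    have hcl : ∀ x, FClosed mul meet δ (⋃ n, FIter mul meet δ n {x}) :=
      fun x => fClosed_iUnion_FIter hidem _
    have hself : ∀ x, x ∈ ⋃ n, FIter mul meet δ n {x} := fun x => Set.mem_iUnion.2 ⟨0, rfl⟩
    have hsub : ∀ {a b}, classMap mul meet δ a ⊆ classMap mul meet δ b → sle meet a b := by
      intro a b hab
      obtain ⟨n, hn⟩ := Set.mem_iUnion.1
        (meet_mem_of_classMap_subset h (hcl a) (hself a) hab)
      exact hA n a b hn
    refine ⟨Set G × Option (Set G), inferInstance, Set.range (classMap mul meet δ), ?_, ?_, ?_,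
      classMap mul meet δ, Set.mem_range_self, fun a b hab => ?_, fun f hf => hf,
      classMap_mul h, classMap_meet h, fun a b => ⟨pr2_classMap_subset_pr1 h hδ, fun hab => ?_⟩⟩
    · rintro _ ⟨g, rfl⟩
      exact isTransformation_classMap h g
    · rintro _ ⟨a, rfl⟩ _ ⟨b, rfl⟩
      exact ⟨mul a b, classMap_mul h a b⟩
    · rintro _ ⟨a, rfl⟩ _ ⟨b, rfl⟩
      exact ⟨meet a b, classMap_meet h a b⟩
    · rw [← show meet a b = a from hsub hab.subset, hcomm]
      exact hsub hab.superset
    · obtain ⟨n, hn⟩ := Set.mem_iUnion.1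
        (mul_mem_of_pr2_classMap_subset h (hcl a) (hself a) hab)
      exact hB n a b hn
end
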